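/- For every K ≥ 1 there exists C > 0 depending only on K with the following property. Assume f : ℝ³ × ℝ × ℝ³ → ℝ is of class C² with f ≥ 1/K everywhere and with |f| and all partial derivatives of f up to order 2 bounded by K; u : ℝ³ → ℝ is C^∞ on B₁₀ with σ₂(D²u(x)) = f(x, u(x), Du(x)) and Δu(x) > 0 on B₁₀; and |u(x)| + |Du(x)| ≤ K on B₁₀. Then for every x₀ ∈ B₁, both ∫_{B₂(x₀)} |D(log Δu)(x)| dx ≤ C and ∫_{B₁(x₀)} Δu(x) · log Δu(x) dx ≤ C. -/

import Mathlib

open Metric MeasureTheory Real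

noncomputable section

abbrev E3 : Type := EuclideanSpace ℝ (Fin 3)

/-- The `i`-th partial derivative of `u`. -/
def pd (i : Fin 3) (u : E3 → ℝ) : E3 → ℝ :=
  fun x => fderiv ℝ u x (EuclideanSpace.single i 1)

/-- The gradient `Du` of `u` as a vector in `ℝ³`. -/
def grad (u : E3 → ℝ) (x : E3) : E3 :=
  (WithLp.equiv 2 (Fin 3 → ℝ)).symm (fun i => pd i u x)

/-- The Hessian matrix `D²u`. -/
def hess (u : E3 → ℝ) (x : E3) : Matrix (Fin 3) (Fin 3) ℝ :=
  Matrix.of fun i j => pd i (pd j u) x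

/-- The Laplacian `Δu`. -/
def lap (u : E3 → ℝ) (x : E3) : ℝ := ∑ i, hess u x i i

def sigma1 (A : Matrix (Fin 3) (Fin 3) ℝ) : ℝ := A.trace

def sigma2 (A : Matrix (Fin 3) (Fin 3) ℝ) : ℝ := (A.trace ^ 2 - (A * A).trace) / 2

def sigma3 (A : Matrix (Fin 3) (Fin 3) ℝ) : ℝ := A.det

/-- The matrix `σ₂^{ij}(x) = Δu(x) δ_{ij} - ∂_i∂_j u(x)`. -/
def sg (u : E3 → ℝ) (x : E3) : Matrix (Fin 3) (Fin 3) ℝ :=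
  lap u x • (1 : Matrix (Fin 3) (Fin 3) ℝ) - hess u x

/-- `f_{u_p}`: the partial derivative of `f` in its `p`-th gradient variable,
evaluated at `(x, u(x), Du(x))`. -/
def fp (f : E3 × ℝ × E3 → ℝ) (u : E3 → ℝ) (p : Fin 3) (x : E3) : ℝ :=
  fderiv ℝ f (x, u x, grad u x) (0, 0, EuclideanSpace.single p 1)

/-- The standing hypotheses: `f` is `C²`, bounded below by `1/K`, with `|f|` and all
derivatives up to order 2 bounded by `K`; `u` is smooth on `B₁₀`, solves
`σ₂(D²u) = f(x,u,Du)` with `Δu > 0` on `B₁₀`, and `|u| + |Du| ≤ K` on `B₁₀`. -/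
def Hyp (K : ℝ) (f : E3 × ℝ × E3 → ℝ) (u : E3 → ℝ) : Prop :=
  ContDiff ℝ 2 f ∧
  (∀ z, 1 / K ≤ f z) ∧
  (∀ z, ∀ k : ℕ, k ≤ 2 → ‖iteratedFDeriv ℝ k f z‖ ≤ K) ∧
  ContDiffOn ℝ (⊤ : ℕ∞) u (ball (0 : E3) 10) ∧
  (∀ x ∈ ball (0 : E3) 10, sigma2 (hess u x) = f (x, u x, grad u x)) ∧
  (∀ x ∈ ball (0 : E3) 10, 0 < lap u x) ∧
  (∀ x ∈ ball (0 : E3) 10, |u x| + ‖grad u x‖ ≤ K)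


def Sm (h : E3 → ℝ) : Prop := ContDiffOn ℝ (⊤ : ℕ∞) h (ball (0 : E3) 10)

lemma Sm.contDiffAt {h : E3 → ℝ} (hh : Sm h) {x : E3} (hx : x ∈ ball (0 : E3) 10) :
    ContDiffAt ℝ (⊤ : ℕ∞) h x := ContDiffOn.contDiffAt hh (isOpen_ball.mem_nhds hx)

lemma Sm.diffAt {h : E3 → ℝ} (hh : Sm h) {x : E3} (hx : x ∈ ball (0 : E3) 10) :
    DifferentiableAt ℝ h x := (hh.contDiffAt hx).differentiableAt (by simp)

lemma Sm.pd {h : E3 → ℝ} (hh : Sm h) (i : Fin 3) : Sm (pd i h) := by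
  have h1 : ContDiffOn ℝ (⊤ : ℕ∞) (fderiv ℝ h) (ball (0 : E3) 10) :=
    ContDiffOn.fderiv_of_isOpen hh isOpen_ball (by simp)
  exact h1.clm_apply contDiffOn_const

lemma Sm.add {h k : E3 → ℝ} (hh : Sm h) (hk : Sm k) : Sm (fun x => h x + k x) :=
  ContDiffOn.add hh hk
lemma Sm.sub {h k : E3 → ℝ} (hh : Sm h) (hk : Sm k) : Sm (fun x => h x - k x) :=
  ContDiffOn.sub hh hk
lemma Sm.mul {h k : E3 → ℝ} (hh : Sm h) (hk : Sm k) : Sm (fun x => h x * k x) :=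
  ContDiffOn.mul hh hk
lemma Sm.cmul {h : E3 → ℝ} (hh : Sm h) (c : ℝ) : Sm (fun x => c * h x) :=
  ContDiffOn.mul contDiffOn_const hh
lemma Sm.sum {h : Fin 3 → E3 → ℝ} (hh : ∀ i, Sm (h i)) : Sm (fun x => ∑ i, h i x) :=
  ContDiffOn.sum (fun i _ => hh i)
lemma Sm.log {h : E3 → ℝ} (hh : Sm h) (hp : ∀ x ∈ ball (0 : E3) 10, 0 < h x) :
    Sm (fun x => Real.log (h x)) :=
  ContDiffOn.log hh (fun x hx => (hp x hx).ne')
lemma Sm.cont {h : E3 → ℝ} (hh : Sm h) : ContinuousOn h (ball (0 : E3) 10) :=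
  ContDiffOn.continuousOn hh

lemma Sm.congr {h k : E3 → ℝ} (hh : Sm h) (hk : ∀ x ∈ ball (0 : E3) 10, k x = h x) : Sm k :=
  ContDiffOn.congr hh hk

section pdl
variable {h k : E3 → ℝ} {x : E3} {i : Fin 3}

lemma pd_of_hasFDerivAt {L : E3 →L[ℝ] ℝ} (hh : HasFDerivAt h L x) :
    pd i h x = L (EuclideanSpace.single i 1) := by
  unfold pd; rw [hh.fderiv]

lemma pd_congr (hx : x ∈ ball (0 : E3) 10) (hk : ∀ y ∈ ball (0 : E3) 10, h y = k y) :
    pd i h x = pd i k x := by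
  unfold pd
  have : h =ᶠ[nhds x] k := by
    filter_upwards [isOpen_ball.mem_nhds hx] with y hy using hk y hy
  rw [this.fderiv_eq]

lemma pd_add (hh : DifferentiableAt ℝ h x) (hk : DifferentiableAt ℝ k x) :
    pd i (fun y => h y + k y) x = pd i h x + pd i k x := by
  rw [pd_of_hasFDerivAt (hh.hasFDerivAt.fun_add hk.hasFDerivAt)]; rfl

lemma pd_sub (hh : DifferentiableAt ℝ h x) (hk : DifferentiableAt ℝ k x) :
    pd i (fun y => h y - k y) x = pd i h x - pd i k x := by
  rw [pd_of_hasFDerivAt (hh.hasFDerivAt.fun_sub hk.hasFDerivAt)]; rfl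

lemma pd_mul (hh : DifferentiableAt ℝ h x) (hk : DifferentiableAt ℝ k x) :
    pd i (fun y => h y * k y) x = pd i h x * k x + h x * pd i k x := by
  rw [pd_of_hasFDerivAt (hh.hasFDerivAt.fun_mul hk.hasFDerivAt)]
  simp [pd]; ring

lemma pd_cmul (c : ℝ) (hh : DifferentiableAt ℝ h x) :
    pd i (fun y => c * h y) x = c * pd i h x := by
  rw [pd_of_hasFDerivAt (hh.hasFDerivAt.const_mul c)]; simp [pd]

lemma pd_sum {h : Fin 3 → E3 → ℝ} (hh : ∀ j, DifferentiableAt ℝ (h j) x) :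
    pd i (fun y => ∑ j, h j y) x = ∑ j, pd i (h j) x := by
  have := HasFDerivAt.fun_sum (u := Finset.univ) (fun j _ => (hh j).hasFDerivAt)
  rw [pd_of_hasFDerivAt this]
  simp [pd]

lemma pd_log (hh : DifferentiableAt ℝ h x) (hp : 0 < h x) :
    pd i (fun y => Real.log (h y)) x = pd i h x / h x := by
  rw [pd_of_hasFDerivAt (hh.hasFDerivAt.log hp.ne')]
  simp [pd]; ring

lemma pd_comm {j : Fin 3} (hh : Sm h) (hx : x ∈ ball (0 : E3) 10) :
    pd i (pd j h) x = pd j (pd i h) x := by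
  have hs : IsSymmSndFDerivAt ℝ h x :=
    (hh.contDiffAt hx).isSymmSndFDerivAt (by
      rw [minSmoothness_of_isRCLikeNormedField]
      exact WithTop.coe_le_coe.2 (le_top : (2 : ℕ∞) ≤ ⊤))
  have hd : DifferentiableAt ℝ (fderiv ℝ h) x := by
    have := (hh.contDiffAt hx).fderiv_right (m := (⊤ : ℕ∞)) (by simp)
    exact this.differentiableAt (by simp)
  have key : ∀ a b : Fin 3, pd a (pd b h) x
      = fderiv ℝ (fderiv ℝ h) x (EuclideanSpace.single a 1) (EuclideanSpace.single b 1) := by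
    intro a b
    have h1 : HasFDerivAt (pd b h) _ x :=
      hd.hasFDerivAt.clm_apply (hasFDerivAt_const (EuclideanSpace.single b (1:ℝ) : E3) x)
    rw [pd_of_hasFDerivAt h1]; simp
  rw [key, key]; exact hs _ _

end pdl


section alg
open Finset

lemma alg1 (T : Fin 3 → Fin 3 → Fin 3 → ℝ) (h1 : ∀ i j k, T i j k = T j i k)
    (h2 : ∀ i j k, T i j k = T i k j) (M : Fin 3 → Fin 3 → ℝ) (hM : ∀ i j, M i j = M j i)
    (a b : Fin 3 → ℝ) :
    2 * ∑ k, (∑ i, T i i k) * a k + 2 * ∑ k, (∑ i, ∑ j, M i j * T i j k) * b k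
      - ((5/3) * ∑ k, a k ^ 2 + (2/3) * ((∑ i, M i i) * ∑ k, a k * b k
        + 2 * ∑ k, a k * ∑ l, M k l * b l)
        + (1/3) * ((∑ i, ∑ j, M i j ^ 2) * ∑ k, b k ^ 2 + 2 * ∑ k, (∑ l, M k l * b l) ^ 2))
      ≤ ∑ i, ∑ j, ∑ k, T i j k ^ 2 := by
  have h0 : 0 ≤ ∑ i, ∑ j, ∑ k, (T i j k - (1/3) * ((if i = j then (1:ℝ) else 0) * a k
      + (if j = k then (1:ℝ) else 0) * a i + (if i = k then (1:ℝ) else 0) * a j)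
      - (1/3) * (M i j * b k + M j k * b i + M i k * b j)) ^ 2 := by positivity
  have t1 := h1 1 0; have t2 := h1 2 0; have t3 := h1 2 1
  have s1 : ∀ i, T i 1 0 = T i 0 1 := fun i => h2 i 1 0
  have s2 : ∀ i, T i 2 0 = T i 0 2 := fun i => h2 i 2 0
  have s3 : ∀ i, T i 2 1 = T i 1 2 := fun i => h2 i 2 1
  have m1 := hM 1 0; have m2 := hM 2 0; have m3 := hM 2 1
  simp only [Fin.sum_univ_three, Fin.isValue] at h0 ⊢
  simp only [t1, t2, t3, s1, s2, s3, m1, m2, m3, Fin.isValue] at h0 ⊢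
  norm_num [Fin.ext_iff] at h0
  linarith

/-- matrix-vector Cauchy-Schwarz -/
lemma mv_le (A : Fin 3 → Fin 3 → ℝ) (v : Fin 3 → ℝ) :
    ∑ i, (∑ j, A i j * v j) ^ 2 ≤ (∑ i, ∑ j, A i j ^ 2) * ∑ j, v j ^ 2 := by
  rw [Finset.sum_mul]
  exact Finset.sum_le_sum fun i _ => Finset.sum_mul_sq_le_sq_mul_sq _ _ _

end alg

lemma alg2 (A : Fin 3 → Fin 3 → ℝ) (hA : ∀ i j, A i j = A j i)
    (T : Fin 3 → Fin 3 → Fin 3 → ℝ) (h1 : ∀ i j k, T i j k = T j i k)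
    (h2 : ∀ i j k, T i j k = T i k j) (t : Fin 3 → ℝ) (ht : ∀ k, t k = ∑ i, T i i k)
    (s f C1 τ : ℝ) (hs : s = ∑ i, A i i) (hs0 : 0 < s) (hf : 0 ≤ f)
    (hA2 : ∑ i, ∑ j, A i j ^ 2 = s ^ 2 - 2 * f) (hτ0 : 0 ≤ τ) (hτ : ∑ k, t k ^ 2 = τ ^ 2)
    (hC1 : 0 ≤ C1) (hG : ∀ k, |s * t k - ∑ i, ∑ j, A i j * T i j k| ≤ C1 * s) :
    ∑ k, t k ^ 2 + (10/9) * ∑ k, t k * (t k - (∑ l, A k l * t l) / s) - 12 * C1 * τ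
      ≤ ∑ i, ∑ j, ∑ k, T i j k ^ 2 := by
  obtain ⟨M, hMdef⟩ : ∃ M : Fin 3 → Fin 3 → ℝ,
      ∀ i j, M i j = (if i = j then (1:ℝ) else 0) - A i j / s := ⟨_, fun _ _ => rfl⟩
  have hMs : ∀ i j, M i j = M j i := by
    intro i j; rw [hMdef, hMdef, hA i j]; simp [eq_comm]
  obtain ⟨w, hw⟩ : ∃ w : Fin 3 → ℝ, ∀ k, w k = ∑ l, M k l * t l := ⟨_, fun _ => rfl⟩
  obtain ⟨z, hz⟩ : ∃ z : Fin 3 → ℝ, ∀ k, z k = ∑ l, M k l * w l := ⟨_, fun _ => rfl⟩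
  have hMv : ∀ (v : Fin 3 → ℝ) k, ∑ l, M k l * v l = v k - (∑ l, A k l * v l) / s := by
    intro v k
    simp only [hMdef, sub_mul, Finset.sum_sub_distrib, Finset.sum_div]
    simp [mul_div_right_comm]
  have hw' : ∀ k, w k = t k - (∑ l, A k l * t l) / s := fun k => by rw [hw, hMv]
  have htr : ∑ i, M i i = 2 := by
    simp only [hMdef, Finset.sum_sub_distrib, ← Finset.sum_div, ← hs]
    simp [hs0.ne']; norm_num
  have hN : ∑ i, ∑ j, M i j ^ 2 = 2 - 2 * f / s ^ 2 := by
    have : ∑ i, ∑ j, M i j ^ 2 = 3 - 2 * (∑ i, A i i) / s + (∑ i, ∑ j, A i j ^ 2) / s ^ 2 := by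
      simp only [hMdef, Fin.sum_univ_three]
      norm_num [Fin.ext_iff]
      field_simp
      ring
    rw [this, ← hs, hA2]; field_simp; ring
  have hN2 : ∑ i, ∑ j, M i j ^ 2 ≤ 2 := by
    rw [hN]; have : 0 ≤ 2 * f / s ^ 2 := by positivity
    linarith
  have hzw : ∑ k, z k ^ 2 ≤ 2 * ∑ k, w k ^ 2 := by
    have := mv_le M w
    simp only [← hz] at this
    exact this.trans (mul_le_mul_of_nonneg_right hN2 (by positivity))
  have hwt : ∑ k, w k ^ 2 ≤ 2 * ∑ k, t k * w k := by
    have h := mv_le A t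
    have h' : ∑ i, (∑ j, A i j * t j) ^ 2 ≤ s ^ 2 * ∑ j, t j ^ 2 := by
      refine h.trans (mul_le_mul_of_nonneg_right ?_ (by positivity))
      rw [hA2]; linarith
    have e : ∀ k, ∑ l, A k l * t l = s * (t k - w k) := by
      intro k; rw [hw']; field_simp; ring
    simp only [e, mul_pow, ← Finset.mul_sum] at h'
    have h'' := le_of_mul_le_mul_left h' (by positivity)
    simp only [Fin.sum_univ_three] at h'' ⊢
    linarith
  have hwn : ∑ k, w k ^ 2 ≤ 2 * τ ^ 2 := by
    have := mv_le M t
    simp only [← hw] at this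
    rw [← hτ]
    exact this.trans (mul_le_mul_of_nonneg_right hN2 (by positivity))
  have htz : ∑ k, t k * z k = ∑ k, w k ^ 2 := by
    have : ∑ k, w k ^ 2 = ∑ k, w k * w k := by simp only [sq]
    rw [this]
    simp only [hz]
    conv_rhs => enter [2, k, 1]; rw [hw]
    have m1 := hMs 1 0; have m2 := hMs 2 0; have m3 := hMs 2 1
    simp only [Fin.sum_univ_three, m1, m2, m3]; ring
  obtain ⟨b, hb⟩ : ∃ b : Fin 3 → ℝ, ∀ k, b k = - t k - (2/3) * w k := ⟨_, fun _ => rfl⟩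
  obtain ⟨a, ha⟩ : ∃ a : Fin 3 → ℝ, ∀ k, a k = t k + w k := ⟨_, fun _ => rfl⟩
  have hMb : ∀ k, ∑ l, M k l * b l = - w k - (2/3) * z k := by
    intro k; rw [hw, hz]; simp only [hb, Fin.sum_univ_three]; ring
  have hbb : ∀ k, |b k| ≤ 2 * τ := by
    intro k
    have a1 : |t k| ≤ τ := by
      apply abs_le_of_sq_le_sq _ hτ0
      rw [← hτ]; exact Finset.single_le_sum (f := fun k => t k ^ 2) (fun i _ => sq_nonneg _) (Finset.mem_univ k)
    have a2 : |w k| ≤ (3/2) * τ := by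
      apply abs_le_of_sq_le_sq _ (by positivity)
      have := Finset.single_le_sum (f := fun k => w k ^ 2) (fun i _ => sq_nonneg _) (Finset.mem_univ k)
      nlinarith
    rw [abs_le] at *
    rw [hb]
    constructor <;> linarith
  have hg : ∀ k, -(2 * C1 * τ) ≤ (∑ i, ∑ j, M i j * T i j k) * b k := by
    intro k
    have e : ∑ i, ∑ j, M i j * T i j k = (s * t k - ∑ i, ∑ j, A i j * T i j k) / s := by
      rw [ht]
      simp only [hMdef, Fin.sum_univ_three]
      norm_num [Fin.ext_iff]
      field_simp
      ring
    have : |∑ i, ∑ j, M i j * T i j k| ≤ C1 := by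
      rw [e, abs_div, abs_of_pos hs0, div_le_iff₀ hs0]; exact hG k
    have := mul_le_mul this (hbb k) (abs_nonneg _) hC1
    rw [← abs_mul] at this
    have := neg_abs_le ((∑ i, ∑ j, M i j * T i j k) * b k)
    linarith
  have main := alg1 T h1 h2 M hMs a b
  simp only [hMb, htr, ← ht] at main
  have hgs : -(6 * C1 * τ) ≤ ∑ k, (∑ i, ∑ j, M i j * T i j k) * b k := by
    have h0 := hg 0; have h1 := hg 1; have h2 := hg 2
    rw [Fin.sum_univ_three (fun k => (∑ i, ∑ j, M i j * T i j k) * b k)]; linarith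
  have hNb := mul_le_mul_of_nonneg_right hN2 (show 0 ≤ ∑ k, b k ^ 2 by positivity)
  simp only [← hw']
  generalize (∑ i, ∑ j, ∑ k, T i j k ^ 2) = TT at *
  generalize (∑ k, (∑ i, ∑ j, M i j * T i j k) * b k) = GG at *
  generalize (∑ i, ∑ j, M i j ^ 2) = N at *
  simp only [Fin.sum_univ_three, ha] at main hNb htz hwt hzw ⊢
  simp only [hb] at main hNb
  nlinarith

/-- ellipticity -/
lemma alg3 (A : Fin 3 → Fin 3 → ℝ) (s f : ℝ) (hs0 : 0 < s) (hf : 0 ≤ f)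
    (hA2 : ∑ i, ∑ j, A i j ^ 2 = s ^ 2 - 2 * f) (v : Fin 3 → ℝ) :
    f / s * ∑ k, v k ^ 2 ≤ ∑ k, v k * (s * v k - ∑ l, A k l * v l) := by
  have h0 : 0 ≤ s ^ 2 - 2 * f := by rw [← hA2]; positivity
  set q := ∑ k, v k ^ 2 with hq
  have hq0 : 0 ≤ q := by positivity
  have e : ∑ k, v k * (s * v k - ∑ l, A k l * v l) = s * q - ∑ k, v k * ∑ l, A k l * v l := by
    rw [hq, Finset.mul_sum, ← Finset.sum_sub_distrib]
    exact Finset.sum_congr rfl fun k _ => by ring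
  rw [e]
  have h1 := Finset.sum_mul_sq_le_sq_mul_sq Finset.univ v (fun k => ∑ l, A k l * v l)
  have h2 := mv_le A v
  rw [hA2] at h2
  rw [← hq] at h1 h2
  have h3 : (∑ k, v k * ∑ l, A k l * v l) ^ 2 ≤ ((s - f / s) * q) ^ 2 := by
    calc _ ≤ q * ((s ^ 2 - 2 * f) * q) := h1.trans (mul_le_mul_of_nonneg_left h2 hq0)
      _ = (s ^ 2 - 2 * f) * q ^ 2 := by ring
      _ ≤ ((s - f / s) ^ 2) * q ^ 2 := by
        refine mul_le_mul_of_nonneg_right ?_ (by positivity)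
        have : (s - f / s) ^ 2 = s ^ 2 - 2 * f + (f / s) ^ 2 := by field_simp; ring
        rw [this]; nlinarith [sq_nonneg (f / s)]
      _ = _ := by ring
  have h4 : 0 ≤ s - f / s := by
    rw [sub_nonneg, div_le_iff₀ hs0]; nlinarith
  have := abs_le_of_sq_le_sq h3 (by positivity)
  have := (abs_le.1 this).2
  linarith

section pde

lemma lap_eq (u : E3 → ℝ) : lap u = fun x => ∑ i, pd i (pd i u) x := rfl

lemma Sm.lap {u : E3 → ℝ} (hu : Sm u) : Sm (lap u) := by
  rw [lap_eq]; exact Sm.sum fun i => (hu.pd i).pd i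

lemma two_sigma2 (u : E3 → ℝ) (hu : Sm u) {x : E3} (hx : x ∈ ball (0 : E3) 10) :
    sigma2 (hess u x) = (1/2) * (lap u x * lap u x - ∑ i, ∑ j, pd i (pd j u) x * pd i (pd j u) x) := by
  have h : ∀ i j, hess u x i j = pd i (pd j u) x := fun _ _ => rfl
  unfold sigma2
  have e1 : (hess u x).trace = lap u x := rfl
  have e2 : (hess u x * hess u x).trace = ∑ i, ∑ j, pd i (pd j u) x * pd i (pd j u) x := by
    simp only [Matrix.trace, Matrix.diag, Matrix.mul_apply, h]
    refine Finset.sum_congr rfl fun i _ => Finset.sum_congr rfl fun j _ => ?_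
    rw [pd_comm (i := j) (j := i) hu hx]
  rw [e1, e2]; ring

variable {u : E3 → ℝ} {x : E3}

lemma T_symm1 (hu : Sm u) (hx : x ∈ ball (0 : E3) 10) (i j k : Fin 3) :
    pd k (pd i (pd j u)) x = pd k (pd j (pd i u)) x :=
  pd_congr hx fun _ hy => pd_comm hu hy

lemma T_symm2 (hu : Sm u) (hx : x ∈ ball (0 : E3) 10) (i j k : Fin 3) :
    pd k (pd i (pd j u)) x = pd j (pd i (pd k u)) x := by
  rw [pd_comm (hu.pd j) hx, T_symm1 hu hx k j i, pd_comm (hu.pd k) hx]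

lemma pd_lap (hu : Sm u) (hx : x ∈ ball (0 : E3) 10) (k : Fin 3) :
    pd k (lap u) x = ∑ i, pd k (pd i (pd i u)) x := by
  rw [lap_eq, pd_sum fun j => ((hu.pd j).pd j).diffAt hx]

lemma pd_pd_lap (hu : Sm u) (hx : x ∈ ball (0 : E3) 10) (i j : Fin 3) :
    pd i (pd j (lap u)) x = ∑ k, pd k (pd k (pd i (pd j u))) x := by
  rw [pd_congr hx fun y hy => pd_lap hu hy j, pd_sum fun k => (((hu.pd k).pd k).pd j).diffAt hx]
  refine Finset.sum_congr rfl fun k _ => ?_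
  rw [pd_congr (i := i) hx fun y hy => T_symm2 hu hy k k j]
  rw [pd_comm (((hu.pd j).pd k)) hx]
  exact pd_congr hx fun y hy => pd_comm (hu.pd j) hy

lemma pd_sigma2 (hu : Sm u) (hx : x ∈ ball (0 : E3) 10) (k : Fin 3) :
    pd k (fun y => sigma2 (hess u y)) x = lap u x * pd k (lap u) x
      - ∑ i, ∑ j, pd i (pd j u) x * pd k (pd i (pd j u)) x := by
  rw [pd_congr hx fun y hy => two_sigma2 u hu hy]
  have s1 := hu.lap
  have s2 : ∀ i, Sm (fun y => ∑ j, pd i (pd j u) y * pd i (pd j u) y) := fun i =>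
    Sm.sum fun j => ((hu.pd j).pd i).mul ((hu.pd j).pd i)
  have s3 := Sm.sum s2
  rw [pd_cmul _ (((s1.mul s1).sub s3).diffAt hx), pd_sub ((s1.mul s1).diffAt hx) (s3.diffAt hx),
    pd_mul (s1.diffAt hx) (s1.diffAt hx), pd_sum fun i => (s2 i).diffAt hx]
  have : ∀ i, pd k (fun y => ∑ j, pd i (pd j u) y * pd i (pd j u) y) x
      = 2 * ∑ j, pd i (pd j u) x * pd k (pd i (pd j u)) x := by
    intro i
    rw [pd_sum fun j => (((hu.pd j).pd i).mul ((hu.pd j).pd i)).diffAt hx, Finset.mul_sum]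
    refine Finset.sum_congr rfl fun j _ => ?_
    rw [pd_mul ((((hu.pd j).pd i)).diffAt hx) ((((hu.pd j).pd i)).diffAt hx)]; ring
  simp only [this, ← Finset.mul_sum]; ring

lemma lap_sigma2 (hu : Sm u) (hx : x ∈ ball (0 : E3) 10) :
    ∑ k, pd k (pd k (fun y => sigma2 (hess u y))) x
      = ∑ k, pd k (lap u) x ^ 2 - ∑ i, ∑ j, ∑ k, pd k (pd i (pd j u)) x ^ 2
      + (lap u x * ∑ k, pd k (pd k (lap u)) x
        - ∑ i, ∑ j, pd i (pd j u) x * pd i (pd j (lap u)) x) := by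
  have s1 := hu.lap
  have hk : ∀ k, pd k (pd k (fun y => sigma2 (hess u y))) x
      = pd k (lap u) x ^ 2 + lap u x * pd k (pd k (lap u)) x
        - ∑ i, ∑ j, (pd k (pd i (pd j u)) x ^ 2
          + pd i (pd j u) x * pd k (pd k (pd i (pd j u))) x) := by
    intro k
    rw [pd_congr hx fun y hy => pd_sigma2 hu hy k]
    have s2 : ∀ i j, Sm (fun y => pd i (pd j u) y * pd k (pd i (pd j u)) y) := fun i j =>
      ((hu.pd j).pd i).mul (((hu.pd j).pd i).pd k)
    rw [pd_sub ((s1.mul (s1.pd k)).diffAt hx) ((Sm.sum fun i => Sm.sum fun j => s2 i j).diffAt hx),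
      pd_mul (s1.diffAt hx) ((s1.pd k).diffAt hx),
      pd_sum fun i => (Sm.sum fun j => s2 i j).diffAt hx]
    congr 1
    · ring
    · refine Finset.sum_congr rfl fun i _ => ?_
      rw [pd_sum fun j => (s2 i j).diffAt hx]
      refine Finset.sum_congr rfl fun j _ => ?_
      rw [pd_mul ((((hu.pd j).pd i)).diffAt hx) ((((hu.pd j).pd i).pd k).diffAt hx)]; ring
  simp only [hk, pd_pd_lap hu hx, Fin.sum_univ_three]
  ring

end pde

section chain

def Jv : (Fin 3 → ℝ) →L[ℝ] E3 := ((EuclideanSpace.equiv (Fin 3) ℝ).symm : (Fin 3 → ℝ) →L[ℝ] E3)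

lemma Jv_apply (c : Fin 3 → ℝ) (i : Fin 3) : Jv c i = c i := rfl

lemma norm_Jv_sq (c : Fin 3 → ℝ) : ‖Jv c‖ ^ 2 = ∑ i, c i ^ 2 := by
  rw [EuclideanSpace.norm_sq_eq]; simp [Jv_apply]

lemma grad_eq (u : E3 → ℝ) (x : E3) : grad u x = Jv (fun i => pd i u x) := rfl

lemma hasFDerivAt_Jv {c : Fin 3 → E3 → ℝ} {x : E3} (hc : ∀ i, DifferentiableAt ℝ (c i) x) :
    HasFDerivAt (fun y => Jv (fun i => c i y))
      (Jv.comp (ContinuousLinearMap.pi fun i => fderiv ℝ (c i) x)) x :=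
  Jv.hasFDerivAt.comp x (hasFDerivAt_pi.2 fun i => (hc i).hasFDerivAt)

variable {K : ℝ} {f : E3 × ℝ × E3 → ℝ} {u : E3 → ℝ}

def Phi (u : E3 → ℝ) (y : E3) : E3 × ℝ × E3 := (y, u y, grad u y)
def Pk (u : E3 → ℝ) (k : Fin 3) (y : E3) : E3 × ℝ × E3 :=
  (EuclideanSpace.single k 1, pd k u y, Jv fun i => pd k (pd i u) y)

lemma hasFDerivAt_Phi (hu : Sm u) {x : E3} (hx : x ∈ ball (0 : E3) 10) :
    ∃ L : E3 →L[ℝ] E3 × ℝ × E3, HasFDerivAt (Phi u) L x ∧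
      ∀ k, L (EuclideanSpace.single k 1) = Pk u k x := by
  refine ⟨_, (hasFDerivAt_id x).prodMk ((hu.diffAt hx).hasFDerivAt.prodMk
    (hasFDerivAt_Jv fun i => (hu.pd i).diffAt hx)), fun k => rfl⟩

lemma hasFDerivAt_Pk (hu : Sm u) {x : E3} (hx : x ∈ ball (0 : E3) 10) (k : Fin 3) :
    ∃ L : E3 →L[ℝ] E3 × ℝ × E3, HasFDerivAt (Pk u k) L x ∧
      L (EuclideanSpace.single k 1) = (0, pd k (pd k u) x, Jv fun i => pd k (pd k (pd i u)) x) := by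
  refine ⟨_, (hasFDerivAt_const _ x).prodMk (((hu.pd k).diffAt hx).hasFDerivAt.prodMk
    (hasFDerivAt_Jv fun i => ((hu.pd i).pd k).diffAt hx)), rfl⟩

lemma pd_chain (hf : ContDiff ℝ 2 f) (hu : Sm u) {x : E3} (hx : x ∈ ball (0 : E3) 10) (k : Fin 3) :
    pd k (fun y => f (Phi u y)) x = fderiv ℝ f (Phi u x) (Pk u k x) := by
  obtain ⟨L, hL, hLk⟩ := hasFDerivAt_Phi hu hx
  have h1 : HasFDerivAt f (fderiv ℝ f (Phi u x)) (Phi u x) :=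
    (hf.differentiable (by norm_num)).differentiableAt.hasFDerivAt
  refine (pd_of_hasFDerivAt (h1.comp x hL)).trans ?_
  simp [hLk]

lemma pd_pd_chain (hf : ContDiff ℝ 2 f) (hu : Sm u) {x : E3} (hx : x ∈ ball (0 : E3) 10)
    (k : Fin 3) :
    pd k (pd k (fun y => f (Phi u y))) x
      = fderiv ℝ (fderiv ℝ f) (Phi u x) (Pk u k x) (Pk u k x)
        + fderiv ℝ f (Phi u x) (0, pd k (pd k u) x, Jv fun i => pd k (pd k (pd i u)) x) := by
  rw [pd_congr hx fun y hy => pd_chain hf hu hy k]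
  obtain ⟨L, hL, hLk⟩ := hasFDerivAt_Phi hu hx
  obtain ⟨L', hL', hLk'⟩ := hasFDerivAt_Pk hu hx k
  have h2 : ContDiff ℝ 1 (fderiv ℝ f) := hf.fderiv_right (by norm_num)
  have h1 : HasFDerivAt (fderiv ℝ f) (fderiv ℝ (fderiv ℝ f) (Phi u x)) (Phi u x) :=
    (h2.differentiable (by norm_num)).differentiableAt.hasFDerivAt
  refine (pd_of_hasFDerivAt ((h1.comp x hL).clm_apply hL')).trans ?_
  simp [hLk, hLk']
  ring

end chain

section bounds
variable {K : ℝ} {f : E3 × ℝ × E3 → ℝ} {u : E3 → ℝ} {x : E3}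

lemma Hyp.sm (h : Hyp K f u) : Sm u := h.2.2.2.1

lemma Hyp.pos (h : Hyp K f u) (hx : x ∈ ball (0 : E3) 10) : 0 < lap u x := h.2.2.2.2.2.1 x hx

lemma Hyp.eq (h : Hyp K f u) (hx : x ∈ ball (0 : E3) 10) :
    sigma2 (hess u x) = f (Phi u x) := h.2.2.2.2.1 x hx

lemma Hyp.gradle (h : Hyp K f u) (hx : x ∈ ball (0 : E3) 10) : ‖grad u x‖ ≤ K := by
  have := h.2.2.2.2.2.2 x hx
  linarith [abs_nonneg (u x)]

lemma sq_le_norm_grad (v : E3 → ℝ) (x : E3) (k : Fin 3) : |pd k v x| ≤ ‖grad v x‖ := by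
  apply abs_le_of_sq_le_sq _ (norm_nonneg _)
  rw [grad_eq, norm_Jv_sq]
  exact Finset.single_le_sum (f := fun k => pd k v x ^ 2) (fun i _ => sq_nonneg _)
    (Finset.mem_univ k)

lemma Hyp.hess_sq (h : Hyp K f u) (hx : x ∈ ball (0 : E3) 10) :
    ∑ i, ∑ j, pd i (pd j u) x ^ 2 = lap u x ^ 2 - 2 * f (Phi u x) := by
  have := two_sigma2 u h.sm hx
  rw [h.eq hx] at this
  simp only [sq]; linarith

lemma Hyp.fpos (hK : 1 ≤ K) (h : Hyp K f u) (z : E3 × ℝ × E3) : 0 < f z :=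
  lt_of_lt_of_le (by positivity) (h.2.1 z)

lemma Hyp.lap_lower (hK : 1 ≤ K) (h : Hyp K f u) (hx : x ∈ ball (0 : E3) 10) :
    1 ≤ K * lap u x := by
  have h1 : 0 ≤ ∑ i, ∑ j, pd i (pd j u) x ^ 2 := by positivity
  rw [h.hess_sq hx] at h1
  have h2 := h.2.1 (Phi u x)
  have h3 : 1 ≤ K * f (Phi u x) := by
    rwa [div_le_iff₀ (by positivity), mul_comm] at h2
  have h4 := h.pos hx
  by_contra hc
  push Not at hc
  have : (K * lap u x) ^ 2 < 1 := by
    have : 0 < K * lap u x := by positivity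
    nlinarith
  nlinarith

lemma Hyp.fd1 (h : Hyp K f u) (z : E3 × ℝ × E3) : ‖fderiv ℝ f z‖ ≤ K := by
  have := h.2.2.1 z 1 (by norm_num)
  rwa [norm_iteratedFDeriv_one] at this

lemma Hyp.fd2 (h : Hyp K f u) (z : E3 × ℝ × E3) : ‖fderiv ℝ (fderiv ℝ f) z‖ ≤ K := by
  have := h.2.2.1 z 2 le_rfl
  rwa [← norm_iteratedFDeriv_fderiv (n := 1), norm_iteratedFDeriv_one] at this

lemma Hyp.norm_Pk (hK : 1 ≤ K) (h : Hyp K f u) (hx : x ∈ ball (0 : E3) 10) (k : Fin 3) :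
    ‖Pk u k x‖ ≤ 3 * K ^ 2 * lap u x := by
  have hl := h.lap_lower hK hx
  have hp := h.pos hx
  have e1 : K ≤ 3 * K ^ 2 * lap u x := by nlinarith
  have e2 : lap u x ≤ 3 * K ^ 2 * lap u x := by nlinarith
  unfold Pk
  rw [Prod.norm_def, Prod.norm_def]
  refine max_le ?_ (max_le ?_ ?_)
  · simp; linarith
  · simp only [Real.norm_eq_abs]
    linarith [sq_le_norm_grad u x k, h.gradle hx]
  · refine le_trans ?_ e2
    refine le_of_sq_le_sq ?_ hp.le
    simp only [norm_Jv_sq]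
    have h1 := h.hess_sq hx
    have h2 := Finset.single_le_sum (f := fun i => ∑ j, pd i (pd j u) x ^ 2)
      (fun i _ => by positivity) (Finset.mem_univ k)
    have h3 := h.fpos hK (Phi u x)
    linarith

lemma Hyp.pd_g (hK : 1 ≤ K) (h : Hyp K f u) (hx : x ∈ ball (0 : E3) 10) (k : Fin 3) :
    |pd k (fun y => sigma2 (hess u y)) x| ≤ 3 * K ^ 3 * lap u x := by
  rw [pd_congr hx fun y hy => h.eq hy, pd_chain h.1 h.sm hx]
  have := (fderiv ℝ f (Phi u x)).le_of_opNorm_le_of_le (h.fd1 _) (h.norm_Pk hK hx k)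
  rw [Real.norm_eq_abs] at this
  linarith

lemma Hyp.lap_g (hK : 1 ≤ K) (h : Hyp K f u) (hx : x ∈ ball (0 : E3) 10) :
    -(28 * K ^ 5 * lap u x ^ 2 + K * ‖grad (lap u) x‖)
      ≤ ∑ k, pd k (pd k (fun y => sigma2 (hess u y))) x := by
  have hl := h.lap_lower hK hx
  have hp := h.pos hx
  have e : ∀ k, pd k (pd k (fun y => sigma2 (hess u y))) x
      = pd k (pd k (fun y => f (Phi u y))) x := fun k =>
    pd_congr hx fun y hy => pd_congr hy fun z hz => h.eq hz
  simp only [e, pd_pd_chain h.1 h.sm hx]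
  rw [Finset.sum_add_distrib, ← map_sum]
  have h1 : ∀ k, -(9 * K ^ 5 * lap u x ^ 2) ≤
      fderiv ℝ (fderiv ℝ f) (Phi u x) (Pk u k x) (Pk u k x) := by
    intro k
    have a1 := (fderiv ℝ (fderiv ℝ f) (Phi u x)).le_of_opNorm_le_of_le (h.fd2 _) (h.norm_Pk hK hx k)
    have a2 := (fderiv ℝ (fderiv ℝ f) (Phi u x) (Pk u k x)).le_of_opNorm_le_of_le a1
      (h.norm_Pk hK hx k)
    rw [Real.norm_eq_abs] at a2
    have := (abs_le.1 a2).1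
    have e : K * (3 * K ^ 2 * lap u x) * (3 * K ^ 2 * lap u x) = 9 * K ^ 5 * lap u x ^ 2 := by ring
    linarith
  have h2 : ∑ k, ((0 : E3), pd k (pd k u) x, Jv fun i => pd k (pd k (pd i u)) x)
      = ((0 : E3), lap u x, grad (lap u) x) := by
    refine Prod.ext ?_ (Prod.ext ?_ ?_)
    · simp [Prod.fst_sum]
    · simp [Prod.fst_sum, Prod.snd_sum, lap_eq]
    · simp only [Prod.snd_sum]
      rw [← map_sum, grad_eq]
      congr 1
      ext i
      rw [Finset.sum_apply, pd_lap h.sm hx]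
      refine Finset.sum_congr rfl fun k _ => ?_
      exact T_symm2 h.sm hx k i k
  rw [h2]
  have h3 : ‖((0 : E3), lap u x, grad (lap u) x)‖ ≤ lap u x + ‖grad (lap u) x‖ := by
    rw [Prod.norm_def, Prod.norm_def]
    have := norm_nonneg (grad (lap u) x)
    refine max_le ?_ (max_le ?_ ?_)
    · simp; linarith
    · simp only [Real.norm_eq_abs, abs_of_pos hp]; linarith
    · simp only; linarith
  have h4 := (fderiv ℝ f (Phi u x)).le_of_opNorm_le_of_le (h.fd1 _) h3
  rw [Real.norm_eq_abs] at h4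
  have h5 := (abs_le.1 h4).1
  have h6 : K * lap u x ≤ K ^ 5 * lap u x ^ 2 := by
    have a : 1 ≤ K ^ 3 := one_le_pow₀ hK
    have b : K * lap u x ≤ (K * lap u x) ^ 2 := by nlinarith
    have c : (K * lap u x) ^ 2 * 1 ≤ (K * lap u x) ^ 2 * K ^ 3 :=
      mul_le_mul_of_nonneg_left a (by positivity)
    have d : (K * lap u x) ^ 2 * K ^ 3 = K ^ 5 * lap u x ^ 2 := by ring
    linarith
  have h7 : -(27 * K ^ 5 * lap u x ^ 2) ≤
      ∑ k, fderiv ℝ (fderiv ℝ f) (Phi u x) (Pk u k x) (Pk u k x) := by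
    rw [Fin.sum_univ_three]; linarith [h1 0, h1 1, h1 2]
  linarith

/-- linearised operator applied to the Laplacian -/
lemma Hyp.L_lap (hK : 1 ≤ K) (h : Hyp K f u) (hx : x ∈ ball (0 : E3) 10) :
    (10/9) * (∑ k, pd k (lap u) x * (lap u x * pd k (lap u) x
        - ∑ l, pd k (pd l u) x * pd l (lap u) x)) / lap u x
      - 28 * K ^ 5 * lap u x ^ 2 - 37 * K ^ 3 * ‖grad (lap u) x‖
      ≤ lap u x * ∑ k, pd k (pd k (lap u)) x
        - ∑ i, ∑ j, pd i (pd j u) x * pd i (pd j (lap u)) x := by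
  have hl := h.lap_lower hK hx
  have hp := h.pos hx
  have hg := h.lap_g hK hx
  rw [lap_sigma2 h.sm hx] at hg
  have key := alg2 (fun i j => pd i (pd j u) x) (fun i j => pd_comm h.sm hx)
    (fun i j k => pd k (pd i (pd j u)) x) (fun i j k => T_symm1 h.sm hx i j k)
    (fun i j k => T_symm2 h.sm hx i j k) (fun k => pd k (lap u) x) (fun k => pd_lap h.sm hx k)
    (lap u x) (f (Phi u x)) (3 * K ^ 3) ‖grad (lap u) x‖ rfl hp (h.fpos hK _).le (h.hess_sq hx)
    (norm_nonneg _) (by rw [grad_eq, norm_Jv_sq]) (by positivity)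
    (fun k => by
      have := h.pd_g hK hx k
      rw [pd_sigma2 h.sm hx] at this
      exact this)
  have e : ∑ k, pd k (lap u) x * (pd k (lap u) x - (∑ l, pd k (pd l u) x * pd l (lap u) x) / lap u x)
      = (∑ k, pd k (lap u) x * (lap u x * pd k (lap u) x
        - ∑ l, pd k (pd l u) x * pd l (lap u) x)) / lap u x := by
    rw [Finset.sum_div]
    refine Finset.sum_congr rfl fun k _ => ?_
    field_simp
  rw [e] at key
  have a : K * ‖grad (lap u) x‖ ≤ K ^ 3 * ‖grad (lap u) x‖ :=
    mul_le_mul_of_nonneg_right (le_self_pow₀ hK (by norm_num)) (norm_nonneg _)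
  rw [mul_div_assoc]
  linarith

def bb (u : E3 → ℝ) : E3 → ℝ := fun y => Real.log (lap u y)

/-- the vector field `F^{ij} b_j` -/
def VV (u : E3 → ℝ) (i : Fin 3) : E3 → ℝ :=
  fun y => lap u y * pd i (bb u) y - ∑ j, pd i (pd j u) y * pd j (bb u) y

def EE (u : E3 → ℝ) (y : E3) : ℝ := ∑ i, pd i (bb u) y * VV u i y

lemma Hyp.bsm (h : Hyp K f u) : Sm (bb u) := h.sm.lap.log fun _ hx => h.pos hx

lemma Hyp.Vsm (h : Hyp K f u) (i : Fin 3) : Sm (VV u i) :=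
  (h.sm.lap.mul (h.bsm.pd i)).sub
    (Sm.sum fun j => ((h.sm.pd j).pd i).mul (h.bsm.pd j))

lemma Hyp.pdb (h : Hyp K f u) (hx : x ∈ ball (0 : E3) 10) (i : Fin 3) :
    pd i (bb u) x = pd i (lap u) x / lap u x := pd_log (h.sm.lap.diffAt hx) (h.pos hx)

lemma Hyp.pdpdb (h : Hyp K f u) (hx : x ∈ ball (0 : E3) 10) (i j : Fin 3) :
    pd i (pd j (bb u)) x = pd i (pd j (lap u)) x / lap u x
      - pd i (bb u) x * pd j (bb u) x := by
  have h1 : pd i (pd j (lap u)) x = pd i (bb u) x * pd j (bb u) x * lap u x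
      + lap u x * pd i (pd j (bb u)) x := by
    have e : ∀ y ∈ ball (0 : E3) 10, pd j (lap u) y = lap u y * pd j (bb u) y := by
      intro y hy
      rw [h.pdb hy]; have := (h.pos hy).ne'; field_simp
    rw [pd_congr hx e, pd_mul (h.sm.lap.diffAt hx) ((h.bsm.pd j).diffAt hx), h.pdb hx i]
    have := (h.pos hx).ne'; field_simp
  rw [h1]; have := (h.pos hx).ne'; field_simp; ring

lemma Hyp.divV (h : Hyp K f u) (hx : x ∈ ball (0 : E3) 10) :
    ∑ i, pd i (VV u i) x = lap u x * ∑ k, pd k (pd k (bb u)) x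
        - ∑ i, ∑ j, pd i (pd j u) x * pd i (pd j (bb u)) x := by
  have s1 := h.sm.lap
  have hi : ∀ i, pd i (VV u i) x = pd i (lap u) x * pd i (bb u) x + lap u x * pd i (pd i (bb u)) x
      - ∑ j, (pd i (pd i (pd j u)) x * pd j (bb u) x + pd i (pd j u) x * pd i (pd j (bb u)) x) := by
    intro i
    have s2 : ∀ j, Sm (fun y => pd i (pd j u) y * pd j (bb u) y) :=
      fun j => ((h.sm.pd j).pd i).mul (h.bsm.pd j)
    unfold VV
    rw [pd_sub ((s1.mul (h.bsm.pd i)).diffAt hx) ((Sm.sum s2).diffAt hx),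
      pd_mul (s1.diffAt hx) ((h.bsm.pd i).diffAt hx), pd_sum fun j => (s2 j).diffAt hx]
    congr 1
    refine Finset.sum_congr rfl fun j _ => ?_
    rw [pd_mul (((h.sm.pd j).pd i).diffAt hx) ((h.bsm.pd j).diffAt hx)]
  have ht : ∀ j, pd j (lap u) x = ∑ i, pd i (pd i (pd j u)) x := by
    intro j; rw [pd_lap h.sm hx]
    exact Finset.sum_congr rfl fun i _ => T_symm2 h.sm hx i i j
  simp only [hi, ht, Fin.sum_univ_three]
  ring

lemma Hyp.EE_lower (hK : 1 ≤ K) (h : Hyp K f u) (hx : x ∈ ball (0 : E3) 10) :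
    ‖grad (bb u) x‖ ^ 2 ≤ K * lap u x * EE u x := by
  have hp := h.pos hx
  have := alg3 (fun i j => pd i (pd j u) x) (lap u x) (f (Phi u x)) hp (h.fpos hK _).le
    (h.hess_sq hx) (fun i => pd i (bb u) x)
  rw [grad_eq, norm_Jv_sq]
  change _ ≤ EE u x at this
  have h2 := h.2.1 (Phi u x)
  have h3 : 1 ≤ K * f (Phi u x) := by
    rwa [div_le_iff₀ (by positivity), mul_comm] at h2
  have hq : 0 ≤ ∑ i, pd i (bb u) x ^ 2 := by positivity
  calc _ ≤ (K * f (Phi u x)) * ∑ i, pd i (bb u) x ^ 2 := le_mul_of_one_le_left hq h3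
    _ = K * lap u x * (f (Phi u x) / lap u x * ∑ i, pd i (bb u) x ^ 2) := by field_simp
    _ ≤ _ := mul_le_mul_of_nonneg_left this (by positivity)

lemma Hyp.EE_nonneg (hK : 1 ≤ K) (h : Hyp K f u) (hx : x ∈ ball (0 : E3) 10) : 0 ≤ EE u x := by
  have h1 := h.EE_lower hK hx
  have hp := h.pos hx
  have : 0 < K * lap u x := by positivity
  by_contra hc
  push Not at hc
  nlinarith [sq_nonneg ‖grad (bb u) x‖]

/-- `|Db| ≤ η E + K s / (4 η)` -/
lemma Hyp.gradb_le (hK : 1 ≤ K) (h : Hyp K f u) (hx : x ∈ ball (0 : E3) 10) {η : ℝ} (hη : 0 < η) :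
    ‖grad (bb u) x‖ ≤ η * EE u x + K / (4 * η) * lap u x := by
  have h1 := h.EE_lower hK hx
  have hp := h.pos hx
  have hE := h.EE_nonneg hK hx
  refine le_of_sq_le_sq (h1.trans ?_) (by positivity)
  have : (η * EE u x + K / (4 * η) * lap u x) ^ 2 - K * lap u x * EE u x
      = (η * EE u x - K / (4 * η) * lap u x) ^ 2 := by field_simp; ring
  nlinarith [sq_nonneg (η * EE u x - K / (4 * η) * lap u x)]

lemma Hyp.jacobi (hK : 1 ≤ K) (h : Hyp K f u) (hx : x ∈ ball (0 : E3) 10) :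
    (1/18) * EE u x - (28 * K ^ 5 + (37 * K ^ 3) ^ 2 * 18 * K / 4) * lap u x
      ≤ ∑ i, pd i (VV u i) x := by
  have hp := h.pos hx
  have h1 := h.L_lap hK hx
  rw [h.divV hx]
  have hb : ∀ k, pd k (lap u) x = lap u x * pd k (bb u) x := by
    intro k; rw [h.pdb hx]; field_simp
  have e1 : ∑ k, pd k (lap u) x * (lap u x * pd k (lap u) x
        - ∑ l, pd k (pd l u) x * pd l (lap u) x) = lap u x ^ 2 * EE u x := by
    simp only [hb, EE, VV, Fin.sum_univ_three]; ring
  have e2 : lap u x * ∑ k, pd k (pd k (lap u)) x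
        - ∑ i, ∑ j, pd i (pd j u) x * pd i (pd j (lap u)) x
      = lap u x * ((lap u x * ∑ k, pd k (pd k (bb u)) x
        - ∑ i, ∑ j, pd i (pd j u) x * pd i (pd j (bb u)) x) + EE u x) := by
    simp only [h.pdpdb hx, EE, VV, Fin.sum_univ_three]; field_simp; ring
  have e3 : ‖grad (lap u) x‖ = lap u x * ‖grad (bb u) x‖ := by
    have : grad (lap u) x = lap u x • grad (bb u) x := by
      rw [grad_eq, grad_eq, ← map_smul]; congr 1; ext i; simp [hb]
    rw [this, norm_smul, Real.norm_eq_abs, abs_of_pos hp]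
  rw [e1, e2, e3] at h1
  have e4 : 10 / 9 * (lap u x ^ 2 * EE u x) / lap u x - 28 * K ^ 5 * lap u x ^ 2 -
      37 * K ^ 3 * (lap u x * ‖grad (bb u) x‖) = lap u x * (10 / 9 * EE u x
      - 28 * K ^ 5 * lap u x - 37 * K ^ 3 * ‖grad (bb u) x‖) := by field_simp
  rw [e4] at h1
  have h2 := le_of_mul_le_mul_left h1 hp
  have hA : 0 < 37 * K ^ 3 := by positivity
  have h3 := h.gradb_le hK hx (η := 1 / (18 * (37 * K ^ 3))) (by positivity)
  have h4 := mul_le_mul_of_nonneg_left h3 hA.le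
  have e5 : 37 * K ^ 3 * (1 / (18 * (37 * K ^ 3)) * EE u x
      + K / (4 * (1 / (18 * (37 * K ^ 3)))) * lap u x)
      = 1 / 18 * EE u x + (37 * K ^ 3) ^ 2 * 18 * K / 4 * lap u x := by
    field_simp
  rw [e5] at h4
  linarith

end bounds

section integrals

structure Cut (η : E3 → ℝ) : Prop where
  smooth : ContDiff ℝ (⊤ : ℕ∞) η
  cpt : HasCompactSupport η
  supp : tsupport η ⊆ ball (0 : E3) 10

lemma Cut.zero {η : E3 → ℝ} (c : Cut η) {x : E3} (hx : x ∉ ball (0 : E3) 10) : η x = 0 :=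
  image_eq_zero_of_notMem_tsupport fun h => hx (c.supp h)

lemma pd_zero_of_notMem {η : E3 → ℝ} {x : E3} (hx : x ∉ tsupport η) (i : Fin 3) :
    pd i η x = 0 := by
  unfold pd
  have : fderiv ℝ η x = 0 := by
    have h := support_fderiv_subset ℝ (f := η)
    by_contra hc
    exact hx (h hc)
  rw [this]; simp

lemma Cut.pd_zero {η : E3 → ℝ} (c : Cut η) {x : E3} (hx : x ∉ ball (0 : E3) 10) (i : Fin 3) :
    pd i η x = 0 := pd_zero_of_notMem (fun h => hx (c.supp h)) i

lemma Cut.sm {η : E3 → ℝ} (c : Cut η) : Sm η := c.smooth.contDiffOn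

lemma Cut.sq {η : E3 → ℝ} (c : Cut η) : Cut (fun x => η x * η x) where
  smooth := c.smooth.mul c.smooth
  cpt := HasCompactSupport.mul_left c.cpt
  supp := (tsupport_mul_subset_left (f := η) (g := η)).trans c.supp

lemma Cut.int {η h : E3 → ℝ} (c : Cut η) (hh : ContinuousOn h (ball (0 : E3) 10)) :
    Integrable (fun x => η x * h x) := by
  have hs : tsupport (fun x => η x * h x) ⊆ tsupport η := tsupport_mul_subset_left
  refine Continuous.integrable_of_hasCompactSupport ?_ (HasCompactSupport.mul_right c.cpt)
  rw [continuous_iff_continuousAt]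
  intro x
  by_cases hx : x ∈ tsupport η
  · exact (c.smooth.continuous.continuousAt).mul
      (hh.continuousAt (isOpen_ball.mem_nhds (c.supp hx)))
  · have : (fun x => η x * h x) =ᶠ[nhds x] fun _ => 0 := by
      filter_upwards [(isClosed_tsupport η).isOpen_compl.mem_nhds hx] with y hy
      rw [image_eq_zero_of_notMem_tsupport hy, zero_mul]
    exact continuousAt_const.congr this.symm

lemma Cut.int0 {η : E3 → ℝ} (c : Cut η) : Integrable η :=
  c.smooth.continuous.integrable_of_hasCompactSupport c.cpt

lemma int_pd_zero {G : E3 → ℝ} (hG : ContDiff ℝ 1 G) (hc : HasCompactSupport G) (i : Fin 3) :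
    Integrable (pd i G) ∧ ∫ x, pd i G x = 0 := by
  have hcont : Continuous (pd i G) := (hG.continuous_fderiv (by norm_num)).clm_apply continuous_const
  have hci : HasCompactSupport (pd i G) := by
    refine HasCompactSupport.intro' hc (isClosed_tsupport _) fun x hx => ?_
    exact pd_zero_of_notMem hx i
  have hi : Integrable (pd i G) := hcont.integrable_of_hasCompactSupport hci
  refine ⟨hi, ?_⟩
  have := integral_mul_fderiv_eq_neg_fderiv_mul_of_integrable (𝕜 := ℝ) (μ := (volume : Measure E3))
    (f := fun _ : E3 => (1:ℝ)) (g := G) (v := EuclideanSpace.single i 1) (by simp)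
    (by simp only [one_mul]; exact hi)
    (by simpa using hG.continuous.integrable_of_hasCompactSupport hc)
    (by fun_prop) (fun x _ => (hG.differentiable (by norm_num)).differentiableAt)
  simpa [pd] using this

lemma Cut.div {η : E3 → ℝ} (c : Cut η) {V : Fin 3 → E3 → ℝ} (hV : ∀ i, Sm (V i)) :
    Integrable (fun x => ∑ i, (pd i η x * V i x + η x * pd i (V i) x)) ∧
    ∫ x, ∑ i, (pd i η x * V i x + η x * pd i (V i) x) = 0 := by
  have hs : ∀ i, tsupport (fun x => η x * V i x) ⊆ tsupport η := fun i => tsupport_mul_subset_left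
  have e : (fun x => ∑ i, (pd i η x * V i x + η x * pd i (V i) x))
      = fun x => ∑ i, pd i (fun y => η y * V i y) x := by
    funext x
    refine Finset.sum_congr rfl fun i _ => ?_
    by_cases hx : x ∈ ball (0 : E3) 10
    · rw [pd_mul (c.sm.diffAt hx) ((hV i).diffAt hx)]
    · rw [c.zero hx, c.pd_zero hx, pd_zero_of_notMem fun h => hx (c.supp (hs i h))]; simp
  have k : ∀ i, Integrable (pd i (fun y => η y * V i y)) ∧ ∫ x, pd i (fun y => η y * V i y) x = 0 := by
    intro i
    refine int_pd_zero ?_ (HasCompactSupport.mul_right c.cpt) i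
    rw [contDiff_iff_contDiffAt]
    intro x
    by_cases hx : x ∈ tsupport η
    swap
    · have h0 : (fun y => η y * V i y) =ᶠ[nhds x] fun _ => 0 := by
        filter_upwards [(isClosed_tsupport η).isOpen_compl.mem_nhds hx] with y hy
        rw [image_eq_zero_of_notMem_tsupport hy, zero_mul]
      exact contDiffAt_const.congr_of_eventuallyEq h0
    have hx' := c.supp hx
    exact ((c.sm.mul (hV i)).contDiffAt hx').of_le (WithTop.coe_le_coe.2 (le_top : (1 : ℕ∞) ≤ ⊤))
  rw [e]
  refine ⟨integrable_finsetSum _ fun i _ => (k i).1, ?_⟩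
  rw [integral_finsetSum _ fun i _ => (k i).1]
  simp [(k _).2]

lemma exists_cut (r R : ℝ) (hr : 0 < r) (hR : r < R) (hR' : R < 10) : ∃ η : E3 → ℝ, Cut η ∧
    (∀ x, 0 ≤ η x) ∧ (∀ x, η x ≤ 1) ∧ (∀ x ∈ closedBall (0 : E3) r, η x = 1) ∧
    tsupport η ⊆ closedBall (0 : E3) R := by
  let φ : ContDiffBump (0 : E3) := ⟨r, R, hr, hR⟩
  refine ⟨φ, ⟨φ.contDiff, φ.hasCompactSupport, ?_⟩, fun x => φ.nonneg, fun x => φ.le_one,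
    fun x hx => φ.one_of_mem_closedBall hx, ?_⟩
  · rw [φ.tsupport_eq]; exact closedBall_subset_ball hR'
  · rw [φ.tsupport_eq]

lemma Cut.bound {η χ : E3 → ℝ} (c : Cut η) (hχ : ∀ x, 0 ≤ χ x) (h1 : ∀ x ∈ tsupport η, χ x = 1) :
    ∃ B, 0 ≤ B ∧ ∀ i x, |pd i η x| ≤ B * χ x := by
  have h : ∀ i, ∃ B, ∀ x, ‖pd i η x‖ ≤ B := by
    intro i
    have hG : ContDiff ℝ 1 η := c.smooth.of_le (WithTop.coe_le_coe.2 (le_top : (1 : ℕ∞) ≤ ⊤))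
    have hcont : Continuous (pd i η) :=
      (hG.continuous_fderiv (by norm_num)).clm_apply continuous_const
    have hci : HasCompactSupport (pd i η) :=
      HasCompactSupport.intro' c.cpt (isClosed_tsupport _) fun x hx => pd_zero_of_notMem hx i
    exact hci.exists_bound_of_continuous hcont
  choose B hB using h
  have hB0 : ∀ i, 0 ≤ B i := fun i => (norm_nonneg _).trans (hB i 0)
  refine ⟨∑ i, B i, Finset.sum_nonneg fun i _ => hB0 i, fun i x => ?_⟩
  by_cases hx : x ∈ tsupport η
  · rw [h1 x hx, mul_one]
    exact (hB i x).trans (Finset.single_le_sum (fun i _ => hB0 i) (Finset.mem_univ i))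
  · rw [pd_zero_of_notMem hx, abs_zero]
    exact mul_nonneg (Finset.sum_nonneg fun i _ => hB0 i) (hχ x)

lemma exists_cuts : ∃ (φ χ ω : E3 → ℝ) (B : ℝ), Cut φ ∧ Cut χ ∧ Cut ω ∧ 0 ≤ B ∧
    (∀ x, 0 ≤ φ x) ∧ (∀ x, φ x ≤ 1) ∧ (∀ x ∈ ball (0 : E3) 3, φ x = 1) ∧
    (∀ x, φ x ≤ χ x) ∧ (∀ x, χ x ≤ 1) ∧ (∀ x, χ x ≤ ω x) ∧
    (∀ i x, |pd i φ x| ≤ B * χ x) ∧ (∀ i x, |pd i χ x| ≤ B * ω x) := by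
  obtain ⟨φ, c1, p1, l1, o1, s1⟩ := exists_cut 3 4 (by norm_num) (by norm_num) (by norm_num)
  obtain ⟨χ, c2, p2, l2, o2, s2⟩ := exists_cut 4 5 (by norm_num) (by norm_num) (by norm_num)
  obtain ⟨ω, c3, p3, l3, o3, s3⟩ := exists_cut 5 6 (by norm_num) (by norm_num) (by norm_num)
  obtain ⟨B1, b1, h1⟩ := c1.bound p2 fun x hx => o2 x (s1 hx)
  obtain ⟨B2, b2, h2⟩ := c2.bound p3 fun x hx => o3 x (s2 hx)
  have mono : ∀ (η ζ : E3 → ℝ), (∀ x, 0 ≤ ζ x) → (∀ x, η x ≤ 1) → (∀ x ∈ tsupport η, ζ x = 1) →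
      ∀ x, η x ≤ ζ x := by
    intro η ζ hp hl ho x
    by_cases hx : x ∈ tsupport η
    · rw [ho x hx]; exact hl x
    · rw [image_eq_zero_of_notMem_tsupport hx]; exact hp x
  refine ⟨φ, χ, ω, B1 + B2, c1, c2, c3, by linarith, p1, l1,
    fun x hx => o1 x (ball_subset_closedBall hx), mono _ _ p2 l1 fun x hx => o2 x (s1 hx), l2,
    mono _ _ p3 l2 fun x hx => o3 x (s2 hx), fun i x => (h1 i x).trans ?_,
    fun i x => (h2 i x).trans ?_⟩
  · exact mul_le_mul_of_nonneg_right (by linarith) (p2 x)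
  · exact mul_le_mul_of_nonneg_right (by linarith) (p3 x)

/-- Cauchy-Schwarz for `F`. -/
lemma alg4 (A : Fin 3 → Fin 3 → ℝ) (hA : ∀ i j, A i j = A j i) (s f : ℝ) (hs0 : 0 < s)
    (hf : 0 ≤ f) (hA2 : ∑ i, ∑ j, A i j ^ 2 = s ^ 2 - 2 * f) (a : ℝ) (b d : Fin 3 → ℝ) :
    -((1/36) * a ^ 2 * ∑ k, b k * (s * b k - ∑ l, A k l * b l)) - 72 * s * ∑ k, d k ^ 2
      ≤ 2 * a * ∑ k, d k * (s * b k - ∑ l, A k l * b l) := by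
  have h1 := alg3 A s f hs0 hf hA2 (fun k => (1/36) * a * b k + d k)
  have h2 := alg3 (fun i j => - A i j) s f hs0 hf (by simpa using hA2) d
  have p1 : 0 ≤ f / s * ∑ k, ((1/36) * a * b k + d k) ^ 2 := by positivity
  have p2 : 0 ≤ f / s * ∑ k, d k ^ 2 := by positivity
  have h1' := p1.trans h1
  have h2' := p2.trans h2
  have m1 := hA 1 0; have m2 := hA 2 0; have m3 := hA 2 1
  simp only [Fin.sum_univ_three, m1, m2, m3] at h1' h2' ⊢
  linarith

end integrals

section final
variable {K : ℝ} {f : E3 × ℝ × E3 → ℝ} {u : E3 → ℝ}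

lemma contOn_grad {v : E3 → ℝ} (hv : Sm v) : ContinuousOn (fun x => ‖grad v x‖) (ball (0 : E3) 10) := by
  refine ContinuousOn.norm ?_
  exact Jv.continuous.comp_continuousOn (continuousOn_pi.2 fun i => (hv.pd i).cont)

lemma contOn_EE (h : Hyp K f u) : ContinuousOn (EE u) (ball (0 : E3) 10) :=
  Sm.cont (Sm.sum fun i => (h.bsm.pd i).mul (h.Vsm i))

lemma Hyp.absb (hK : 1 ≤ K) (h : Hyp K f u) {x : E3} (hx : x ∈ ball (0 : E3) 10) :
    |bb u x| ≤ lap u x + K := by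
  have hp := h.pos hx
  have h1 := Real.log_le_sub_one_of_pos hp
  have h2 := Real.one_sub_inv_le_log_of_pos hp
  have h3 : (lap u x)⁻¹ ≤ K := by
    rw [inv_le_iff_one_le_mul₀ hp]; exact h.lap_lower hK hx
  unfold bb
  rw [abs_le]; constructor <;> linarith

end final

/-- Integral gradient estimates: for every `x₀ ∈ B₁`,
`∫_{B₂(x₀)} |D(log Δu)| ≤ C` and `∫_{B₁(x₀)} Δu · log Δu ≤ C`. -/
theorem stmt_19 :
    ∀ K : ℝ, 1 ≤ K → ∃ C : ℝ, 0 < C ∧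
      ∀ (f : E3 × ℝ × E3 → ℝ) (u : E3 → ℝ), Hyp K f u →
        ∀ x₀ ∈ ball (0 : E3) 1,
          (∫ x in ball x₀ 2, ‖grad (fun y => Real.log (lap u y)) x‖) ≤ C ∧
          (∫ x in ball x₀ 1, lap u x * Real.log (lap u x)) ≤ C := by
  intro K hK
  obtain ⟨φ, χ, ω, B, cφ, cχ, cω, hB, φ0, φ1, φone, φχ, χ1, χω, dφ, dχ⟩ := exists_cuts
  have χ0 : ∀ x, 0 ≤ χ x := fun x => (φ0 x).trans (φχ x)
  have ω0 : ∀ x, 0 ≤ ω x := fun x => (χ0 x).trans (χω x)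
  obtain ⟨I, hI⟩ : ∃ I, I = ∫ x, ω x := ⟨_, rfl⟩
  have hI0 : 0 ≤ I := by rw [hI]; exact integral_nonneg ω0
  obtain ⟨a, ha⟩ : ∃ a, a = 3 * B * K * I := ⟨_, rfl⟩
  obtain ⟨C1, hC1⟩ : ∃ C1, C1 = 28 * K ^ 5 + (37 * K ^ 3) ^ 2 * 18 * K / 4 := ⟨_, rfl⟩
  obtain ⟨C2, hC2⟩ : ∃ C2, C2 = C1 + 216 * B ^ 2 := ⟨_, rfl⟩
  obtain ⟨g, hg⟩ : ∃ g, g = 36 * (C2 * a) + K * a := ⟨_, rfl⟩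
  obtain ⟨q, hq⟩ : ∃ q, q = 6 * B * K * (a + K * I) + 3 * K * g + I := ⟨_, rfl⟩
  have K0 : 0 < K := by linarith
  have hC10 : 0 ≤ C1 := by rw [hC1]; positivity
  have hC20 : 0 ≤ C2 := by rw [hC2]; positivity
  have ha0 : 0 ≤ a := by rw [ha]; positivity
  have hg0 : 0 ≤ g := by rw [hg]; positivity
  have hq0 : 0 ≤ q := by rw [hq]; positivity
  refine ⟨g + q + 1, by linarith, ?_⟩
  intro f u h x₀ hx₀
  have cφ2 := cφ.sq
  have sub : ∀ r : ℝ, r ≤ 2 → ball x₀ r ⊆ ball (0 : E3) 3 := by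
    intro r hr
    apply ball_subset_ball'
    rw [mem_ball] at hx₀
    linarith
  have sub10 : ball (0 : E3) 3 ⊆ ball (0 : E3) 10 := ball_subset_ball (by norm_num)
  have φsq : ∀ x, φ x * φ x ≤ χ x := fun x => by nlinarith [φ0 x, φ1 x, φχ x]
  have dφ2 : ∀ i x, pd i φ x ^ 2 ≤ B ^ 2 * χ x := by
    intro i x
    have h1 : pd i φ x ^ 2 ≤ (B * χ x) ^ 2 := by
      rw [← sq_abs]; exact pow_le_pow_left₀ (abs_nonneg _) (dφ i x) 2
    have h2 : χ x ^ 2 ≤ χ x := by nlinarith [χ0 x, χ1 x]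
    nlinarith [mul_le_mul_of_nonneg_left h2 (sq_nonneg B)]
  have pdφ2 : ∀ i x, pd i (fun y => φ y * φ y) x = 2 * φ x * pd i φ x := by
    intro i x
    have hd : DifferentiableAt ℝ φ x := (cφ.smooth.differentiable (by simp)).differentiableAt
    rw [pd_mul hd hd]; ring
  -- step 1 : mass bound
  have iχs : Integrable (fun x => χ x * lap u x) := cχ.int h.sm.lap.cont
  have st1 : ∫ x, χ x * lap u x ≤ a := by
    obtain ⟨d1, d2⟩ := cχ.div (V := fun i => pd i u) fun i => h.sm.pd i
    have : ∫ x, χ x * lap u x ≤ ∫ x, ((∑ i, (pd i χ x * pd i u x + χ x * pd i (pd i u) x))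
        + (3 * B * K) * ω x) := by
      refine integral_mono iχs (d1.add (cω.int0.const_mul _)) fun x => ?_
      by_cases hx : x ∈ ball (0 : E3) 10
      · have e : ∀ i, -(B * K * ω x) ≤ pd i χ x * pd i u x := by
          intro i
          have h1 := mul_le_mul (dχ i x) ((sq_le_norm_grad u x i).trans (h.gradle hx))
            (abs_nonneg _) (mul_nonneg hB (ω0 x))
          rw [← abs_mul] at h1
          have := (abs_le.1 h1).1
          linarith
        have e0 := e 0; have e1 := e 1; have e2 := e 2
        simp only [lap_eq, Fin.sum_univ_three]
        linarith
      · simp only [cχ.zero hx, cχ.pd_zero hx, cω.zero hx]; simp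
    rw [integral_add d1 (cω.int0.const_mul _), d2, integral_const_mul, ← hI] at this
    linarith
  -- step 2 : energy bound
  have iE : Integrable (fun x => φ x * φ x * EE u x) := cφ2.int (contOn_EE h)
  have st2 : ∫ x, φ x * φ x * EE u x ≤ 36 * (C2 * a) := by
    obtain ⟨d1, d2⟩ := cφ2.div (V := VV u) fun i => h.Vsm i
    have : ∫ x, (1/36) * (φ x * φ x * EE u x) ≤ ∫ x, ((∑ i, (pd i (fun y => φ y * φ y) x * VV u i x
        + φ x * φ x * pd i (VV u i) x)) + C2 * (χ x * lap u x)) := by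
      refine integral_mono (iE.const_mul _) (d1.add (iχs.const_mul _)) fun x => ?_
      by_cases hx : x ∈ ball (0 : E3) 10
      · have hp := h.pos hx
        have j := mul_le_mul_of_nonneg_left (h.jacobi hK hx) (mul_self_nonneg (φ x))
        have k := alg4 (fun i j => pd i (pd j u) x) (fun i j => pd_comm h.sm hx) (lap u x)
          (f (Phi u x)) hp (h.fpos hK _).le (h.hess_sq hx) (φ x) (fun i => pd i (bb u) x)
          (fun i => pd i φ x)
        change -((1/36) * φ x ^ 2 * EE u x) - _ ≤ 2 * φ x * ∑ i, pd i φ x * VV u i x at k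
        rw [← hC1] at j
        have m1 : φ x * φ x * (C1 * lap u x) ≤ C1 * (χ x * lap u x) := by
          have := mul_le_mul_of_nonneg_right (φsq x) (mul_nonneg hC10 hp.le)
          linarith
        have m2 : 72 * lap u x * ∑ k, pd k φ x ^ 2 ≤ 216 * B ^ 2 * (χ x * lap u x) := by
          have : ∑ k, pd k φ x ^ 2 ≤ 3 * (B ^ 2 * χ x) := by
            rw [Fin.sum_univ_three]; linarith [dφ2 0 x, dφ2 1 x, dφ2 2 x]
          have := mul_le_mul_of_nonneg_left this (show 0 ≤ 72 * lap u x by positivity)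
          linarith
        simp only [pdφ2]
        have e : ∑ i, (2 * φ x * pd i φ x * VV u i x + φ x * φ x * pd i (VV u i) x)
            = 2 * φ x * ∑ i, pd i φ x * VV u i x + φ x * φ x * ∑ i, pd i (VV u i) x := by
          simp only [Fin.sum_univ_three]; ring
        rw [e, hC2]
        linarith
      · simp only [pdφ2, cφ.zero hx, cχ.zero hx]; simp
    rw [integral_add d1 (iχs.const_mul _), d2, integral_const_mul, integral_const_mul] at this
    have := mul_le_mul_of_nonneg_left st1 hC20
    linarith
  -- step 3 : gradient bound
  have iG : Integrable (fun x => φ x * φ x * ‖grad (bb u) x‖) := cφ2.int (contOn_grad h.bsm)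
  have st3 : ∫ x, φ x * φ x * ‖grad (bb u) x‖ ≤ g := by
    have : ∫ x, φ x * φ x * ‖grad (bb u) x‖ ≤ ∫ x, (φ x * φ x * EE u x + K * (χ x * lap u x)) := by
      refine integral_mono iG (iE.add (iχs.const_mul _)) fun x => ?_
      by_cases hx : x ∈ ball (0 : E3) 10
      · have hp := h.pos hx
        have k := mul_le_mul_of_nonneg_left (h.gradb_le hK hx one_pos) (mul_self_nonneg (φ x))
        have m1 := mul_le_mul_of_nonneg_right (φsq x) (mul_nonneg K0.le hp.le)
        have m2 : 0 ≤ φ x * φ x * (K * lap u x) :=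
          mul_nonneg (mul_self_nonneg _) (mul_nonneg K0.le hp.le)
        simp only
        linarith
      · simp only [cφ.zero hx, cχ.zero hx]; simp
    rw [integral_add iE (iχs.const_mul _), integral_const_mul] at this
    have := mul_le_mul_of_nonneg_left st1 K0.le
    linarith
  have cont4 : ContinuousOn (fun x => lap u x * bb u x + 1) (ball (0 : E3) 10) :=
    (h.sm.lap.mul h.bsm).cont.add continuousOn_const
  have iS : Integrable (fun x => φ x * φ x * (lap u x * bb u x + 1)) := cφ2.int cont4
  have st4 : ∫ x, φ x * φ x * (lap u x * bb u x + 1) ≤ q := by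
    obtain ⟨d1, d2⟩ := cφ2.div (V := fun i y => bb u y * pd i u y) fun i => h.bsm.mul (h.sm.pd i)
    have iR0 : Integrable (fun x => (6 * B * K) * (χ x * lap u x) + (6 * B * K * K + 1) * ω x) :=
      (iχs.const_mul _).add (cω.int0.const_mul _)
    have iR : Integrable (fun x => (6 * B * K) * (χ x * lap u x) + (6 * B * K * K + 1) * ω x
          + (3 * K) * (φ x * φ x * ‖grad (bb u) x‖)) :=
      iR0.add (iG.const_mul _)
    have : ∫ x, φ x * φ x * (lap u x * bb u x + 1) ≤
        ∫ x, ((∑ i, (pd i (fun y => φ y * φ y) x * (bb u x * pd i u x)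
        + φ x * φ x * pd i (fun y => bb u y * pd i u y) x))
        + ((6 * B * K) * (χ x * lap u x) + (6 * B * K * K + 1) * ω x
          + (3 * K) * (φ x * φ x * ‖grad (bb u) x‖))) := by
      refine integral_mono iS (d1.add iR) fun x => ?_
      by_cases hx : x ∈ ball (0 : E3) 10
      · have hp := h.pos hx
        have hgu : ∀ i, |pd i u x| ≤ K := fun i => (sq_le_norm_grad u x i).trans (h.gradle hx)
        have e1 : ∀ i, -(2 * B * K * (χ x * lap u x) + 2 * B * K * K * ω x)
            ≤ 2 * φ x * pd i φ x * (bb u x * pd i u x) := by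
          intro i
          have k1 : |φ x * pd i φ x| ≤ B * χ x := by
            rw [abs_mul, abs_of_nonneg (φ0 x)]
            exact (mul_le_of_le_one_left (abs_nonneg _) (φ1 x)).trans (dφ i x)
          have k2 : |bb u x * pd i u x| ≤ (lap u x + K) * K := by
            rw [abs_mul]
            exact mul_le_mul (h.absb hK hx) (hgu i) (abs_nonneg _) (by positivity)
          have k3 := mul_le_mul k1 k2 (abs_nonneg _) (mul_nonneg hB (χ0 x))
          rw [← abs_mul] at k3
          have k4 := (abs_le.1 k3).1
          have k5 := mul_le_mul_of_nonneg_left (χω x) (show 0 ≤ B * K * K by positivity)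
          linarith
        have e2 : ∀ i, -(K * (φ x * φ x * ‖grad (bb u) x‖))
            ≤ φ x * φ x * (pd i (bb u) x * pd i u x) := by
          intro i
          have k3 := mul_le_mul (sq_le_norm_grad (bb u) x i) (hgu i) (abs_nonneg _) (norm_nonneg _)
          rw [← abs_mul] at k3
          have k4 := mul_le_mul_of_nonneg_left (abs_le.1 k3).1 (mul_self_nonneg (φ x))
          linarith
        have e3 : ∀ i, pd i (fun y => bb u y * pd i u y) x
            = pd i (bb u) x * pd i u x + bb u x * pd i (pd i u) x := fun i =>
          pd_mul (h.bsm.diffAt hx) ((h.sm.pd i).diffAt hx)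
        have e4 : φ x * φ x ≤ ω x := (φsq x).trans (χω x)
        simp only [pdφ2, e3, lap_eq, Fin.sum_univ_three]
        have a0 := e1 0; have a1 := e1 1; have a2 := e1 2
        have b0 := e2 0; have b1 := e2 1; have b2 := e2 2
        simp only [lap_eq, Fin.sum_univ_three] at a0 a1 a2
        linarith
      · simp only [pdφ2, cφ.zero hx, cχ.zero hx, cω.zero hx]; simp
    rw [integral_add d1 iR, d2, integral_add iR0
      (iG.const_mul _), integral_add (iχs.const_mul _) (cω.int0.const_mul _), integral_const_mul,
      integral_const_mul, integral_const_mul, ← hI] at this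
    have k1 := mul_le_mul_of_nonneg_left st1 (show 0 ≤ 6 * B * K by positivity)
    have k2 := mul_le_mul_of_nonneg_left st3 (show 0 ≤ 3 * K by positivity)
    rw [hq]
    linarith
  constructor
  · have e : ∫ x in ball x₀ 2, ‖grad (fun y => Real.log (lap u y)) x‖
        = ∫ x in ball x₀ 2, φ x * φ x * ‖grad (bb u) x‖ := by
      refine setIntegral_congr_fun measurableSet_ball fun x hx => ?_
      simp only [φone x (sub 2 le_rfl hx), one_mul]
      rfl
    rw [e]
    have := setIntegral_le_integral (s := ball x₀ 2) iG
      (Filter.Eventually.of_forall fun x => mul_nonneg (mul_self_nonneg (φ x)) (norm_nonneg _))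
    linarith
  · have nonneg : ∀ x, 0 ≤ φ x * φ x * (lap u x * bb u x + 1) := by
      intro x
      by_cases hx : x ∈ ball (0 : E3) 10
      · have hp := h.pos hx
        have h2 := Real.one_sub_inv_le_log_of_pos hp
        have h3 := mul_le_mul_of_nonneg_left h2 hp.le
        have h4 : lap u x * (1 - (lap u x)⁻¹) = lap u x - 1 := by field_simp
        rw [h4] at h3
        refine mul_nonneg (mul_self_nonneg _) ?_
        change 0 ≤ lap u x * Real.log (lap u x) + 1
        linarith
      · simp [cφ.zero hx]
    have i0 : Integrable (fun x => φ x * φ x * (lap u x * bb u x)) :=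
      cφ2.int (h.sm.lap.mul h.bsm).cont
    have e : ∫ x in ball x₀ 1, lap u x * Real.log (lap u x)
        = ∫ x in ball x₀ 1, φ x * φ x * (lap u x * bb u x) := by
      refine setIntegral_congr_fun measurableSet_ball fun x hx => ?_
      simp only [φone x (sub 1 one_le_two hx), one_mul]
      rfl
    rw [e]
    have h1 : ∫ x in ball x₀ 1, φ x * φ x * (lap u x * bb u x)
        ≤ ∫ x in ball x₀ 1, φ x * φ x * (lap u x * bb u x + 1) := by
      refine setIntegral_mono i0.integrableOn iS.integrableOn fun x => ?_
      simp only
      nlinarith [mul_self_nonneg (φ x)]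
    have := setIntegral_le_integral (s := ball x₀ 1) iS (Filter.Eventually.of_forall nonneg)
    linarith
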